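/- Consider the affine control system ẋ(t) = X₀(x(t)) + Σᵢ₌₁ᵐ uᵢ(t)·bᵢ on ℝⁿ, where b₁, …, b_m ∈ ℝⁿ are constant vectors and X₀ = p₀ + p₁ + … + p_k, with each pⱼ : ℝⁿ → ℝⁿ a vector field whose components are homogeneous polynomials of degree j, and with k odd. Suppose the smallest linear subspace of ℝⁿ that contains b₁, …, b_m and is invariant under p_k (i.e., p_k maps the subspace into itself) is ℝⁿ itself. Then the system is strongly controllable: for every x ∈ ℝⁿ and every T > 0, every point of ℝⁿ is reachable from x in time at most T using piecewise constant controls. -/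

import Mathlib

noncomputable section
open Real Set Matrix Filter

/-- `u` is piecewise constant on `[s, t]`: there is a partition of `[s, t]` on each of whose
open subintervals `u` is constant. -/
def PiecewiseConstantOn {F : Type*} (u : ℝ → F) (s t : ℝ) : Prop :=
  ∃ m : ℕ, ∃ τ : Fin (m + 1) → ℝ, τ 0 = s ∧ τ (Fin.last m) = t ∧ Monotone τ ∧
    ∀ k : Fin m, ∀ r ∈ Set.Ioo (τ k.castSucc) (τ k.succ),
      ∀ r' ∈ Set.Ioo (τ k.castSucc) (τ k.succ), u r = u r'

open scoped NNReal

section Trajectories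

variable {E F : Type*} [NormedAddCommGroup E] [NormedSpace ℝ E] [NormedAddCommGroup F]

/-- If the derivative of `γ` is a constant `c` up to an error of size `η (‖γ‖ + A)`, then `γ` stays
bounded and its displacement is `c` up to an error proportional to `η`. -/
lemma norm_le_and_displacement_le {γ ρ : ℝ → E} {c : E} {η A : ℝ} (hη0 : 0 ≤ η) (hη : η ≤ 1 / 2)
    (hA : 0 ≤ A)
    (hγ : ∀ t ∈ Icc (0 : ℝ) 1, HasDerivWithinAt γ (c + ρ t) (Icc 0 1) t)
    (hρ : ∀ t ∈ Icc (0 : ℝ) 1, ‖ρ t‖ ≤ η * (‖γ t‖ + A)) :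
    (∀ t ∈ Icc (0 : ℝ) 1, ‖γ t‖ ≤ 2 * (‖γ 0‖ + ‖c‖) + A) ∧
      ‖γ 1 - γ 0 - c‖ ≤ η * (2 * (‖γ 0‖ + ‖c‖) + 2 * A) := by
  have hcont : ContinuousOn γ (Icc 0 1) := fun t ht => (hγ t ht).continuousWithinAt
  obtain ⟨s, hs, hmax⟩ := isCompact_Icc.exists_isMaxOn ⟨0, by simp⟩ hcont.norm
  have hmax' : ∀ t ∈ Icc (0 : ℝ) 1, ‖γ t‖ ≤ ‖γ s‖ := fun t ht => hmax ht
  have hbound : ∀ t ∈ Icc (0 : ℝ) 1, ‖ρ t‖ ≤ η * (‖γ s‖ + A) := fun t ht =>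
    (hρ t ht).trans (by gcongr; exact hmax' t ht)
  have hdisp : ∀ t ∈ Icc (0 : ℝ) 1, ‖γ t - γ 0 - t • c‖ ≤ η * (‖γ s‖ + A) := by
    intro t ht
    have hd : ∀ r ∈ Icc (0 : ℝ) 1,
        HasDerivWithinAt (fun r => γ r - r • c) (ρ r) (Icc 0 1) r := by
      intro r hr
      convert! (hγ r hr).sub ((hasDerivWithinAt_id r _).smul_const c) using 1
      simp
    have h := (convex_Icc (0 : ℝ) 1).norm_image_sub_le_of_norm_hasDerivWithin_le hd hbound
      (left_mem_Icc.2 zero_le_one) ht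
    have hC : 0 ≤ η * (‖γ s‖ + A) := by positivity
    calc ‖γ t - γ 0 - t • c‖ = ‖γ t - t • c - (γ 0 - (0 : ℝ) • c)‖ := by
          congr 1; simp; abel
      _ ≤ η * (‖γ s‖ + A) * ‖t - 0‖ := h
      _ ≤ η * (‖γ s‖ + A) * 1 := by
          gcongr
          rw [sub_zero, Real.norm_eq_abs, abs_of_nonneg ht.1]
          exact ht.2
      _ = _ := mul_one _
  have hs' : ‖γ s‖ ≤ 2 * (‖γ 0‖ + ‖c‖) + A := by
    have h1 : ‖γ s‖ ≤ ‖γ s - γ 0 - s • c‖ + ‖γ 0‖ + ‖s • c‖ := by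
      have : γ s = (γ s - γ 0 - s • c) + γ 0 + s • c := by abel
      calc ‖γ s‖ = ‖(γ s - γ 0 - s • c) + γ 0 + s • c‖ := by rw [← this]
        _ ≤ _ := norm_add₃_le
    have h2 : ‖s • c‖ ≤ ‖c‖ := by
      rw [norm_smul, Real.norm_eq_abs, abs_of_nonneg hs.1]
      exact mul_le_of_le_one_left (norm_nonneg _) hs.2
    have h3 : η * (‖γ s‖ + A) ≤ 1 / 2 * (‖γ s‖ + A) := by gcongr
    linarith [hdisp s hs]
  refine ⟨fun t ht => (hmax' t ht).trans hs', ?_⟩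
  have h := hdisp 1 (right_mem_Icc.2 zero_le_one)
  rw [one_smul] at h
  exact h.trans (mul_le_mul_of_nonneg_left (by linarith) hη0)

/-- `γ` solves `γ' = w(σ) + g(γ, σ)` on `[0, 1]` with initial value `x`, where `z = (x, σ)`. -/
def IsTrajectory (w : F → E) (g : E × F → E) (z : E × F) (γ : ℝ → E) : Prop :=
  γ 0 = z.1 ∧ ∀ t ∈ Icc (0 : ℝ) 1, HasDerivWithinAt γ (w z.2 + g (γ t, z.2)) (Icc 0 1) t

lemma exists_isTrajectory [CompleteSpace E] (w : F → E) {g : E × F → E} {η : ℝ≥0}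
    (hη : η ≤ 1 / 2) (hg : LipschitzWith η g) (hg0 : ‖g 0‖ ≤ η) (z : E × F) :
    ∃ γ, IsTrajectory w g z γ := by
  have hη' : (η : ℝ) ≤ 1 / 2 := by exact_mod_cast hη
  set a : ℝ≥0 := 2 * (‖w z.2‖₊ + 1 + ‖z‖₊) with ha
  have hlip : LipschitzWith η fun x => w z.2 + g (x, z.2) := by
    refine LipschitzWith.of_dist_le_mul fun x y => ?_
    rw [dist_add_left]
    simpa [Prod.dist_eq] using hg.dist_le_mul (x, z.2) (y, z.2)
  have hPL : IsPicardLindelof (fun _ x => w z.2 + g (x, z.2))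
      (⟨0, by simp⟩ : Icc (0 : ℝ) 1) z.1 a 0 a η := by
    refine IsPicardLindelof.of_time_independent (fun x hx => ?_) hlip.lipschitzOnWith (by simp)
    have h1 : ‖g (x, z.2)‖ ≤ η + η * ‖(x, z.2)‖ := by
      have := hg.norm_sub_le (x, z.2) 0
      rw [sub_zero] at this
      linarith [norm_le_norm_add_norm_sub' (g (x, z.2)) (g 0)]
    have h2 : ‖(x, z.2)‖ ≤ ‖z‖ + a := by
      have hx' : ‖x‖ ≤ ‖z.1‖ + a := by
        rw [mem_closedBall_iff_norm] at hx
        linarith [norm_le_norm_add_norm_sub' x z.1]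
      refine max_le (hx'.trans (by gcongr; exact norm_fst_le z)) ?_
      have := norm_snd_le z
      exact this.trans (le_add_of_nonneg_right a.2)
    have h3 : (η : ℝ) * ‖(x, z.2)‖ ≤ 1 / 2 * (‖z‖ + a) := by gcongr
    have h4 : (a : ℝ) = 2 * (‖w z.2‖ + 1 + ‖z‖) := by simp [ha]
    linarith [norm_add_le (w z.2) (g (x, z.2)), norm_nonneg z, norm_nonneg (w z.2)]
  obtain ⟨γ, h0, hγ⟩ := hPL.exists_eq_forall_mem_Icc_hasDerivWithinAt₀
  exact ⟨γ, h0, hγ⟩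

lemma IsTrajectory.norm_le {w : F → E} {g : E × F → E} {η : ℝ≥0} {z : E × F} {γ : ℝ → E}
    (hη : η ≤ 1 / 2) (hg : LipschitzWith η g) (hg0 : ‖g 0‖ ≤ η) (h : IsTrajectory w g z γ) :
    (∀ t ∈ Icc (0 : ℝ) 1, ‖γ t‖ ≤ 3 * ‖z‖ + 2 * ‖w z.2‖ + 1) ∧
      ‖γ 1 - z.1 - w z.2‖ ≤ η * (4 * ‖z‖ + 2 * ‖w z.2‖ + 2) := by
  have key := norm_le_and_displacement_le (A := ‖z‖ + 1) η.coe_nonneg (by exact_mod_cast hη)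
    (by positivity) h.2 (fun t _ => by
      have h1 := hg.norm_sub_le (γ t, z.2) 0
      rw [sub_zero] at h1
      have h2 : ‖(γ t, z.2)‖ ≤ ‖γ t‖ + ‖z‖ :=
        max_le (le_add_of_nonneg_right (norm_nonneg _))
          ((norm_snd_le z).trans (le_add_of_nonneg_left (norm_nonneg _)))
      have h3 : (η : ℝ) * ‖(γ t, z.2)‖ ≤ η * (‖γ t‖ + ‖z‖) := by gcongr
      have h4 := norm_le_norm_add_norm_sub' (g (γ t, z.2)) (g 0)
      calc _ ≤ η + η * (‖γ t‖ + ‖z‖) := by linarith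
        _ = _ := by ring)
  rw [h.1] at key
  have hz := norm_fst_le z
  refine ⟨fun t ht => (key.1 t ht).trans (by linarith), key.2.trans ?_⟩
  exact mul_le_mul_of_nonneg_left (by linarith) η.coe_nonneg

lemma IsTrajectory.displacement_sub_le {w : F → E} {g : E × F → E} {η : ℝ≥0} {z z' : E × F}
    {γ γ' : ℝ → E} (hη : η ≤ 1 / 2) (hg : LipschitzWith η g) (h : IsTrajectory w g z γ)
    (h' : IsTrajectory w g z' γ') :
    ‖(γ 1 - z.1 - w z.2) - (γ' 1 - z'.1 - w z'.2)‖ ≤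
      η * (4 * ‖z - z'‖ + 2 * ‖w z.2 - w z'.2‖) := by
  have key := norm_le_and_displacement_le (γ := fun t => γ t - γ' t) (c := w z.2 - w z'.2)
    (ρ := fun t => g (γ t, z.2) - g (γ' t, z'.2)) (A := ‖z - z'‖) η.coe_nonneg (by exact_mod_cast hη)
    (by positivity)
    (fun t ht => by convert! (h.2 t ht).sub (h'.2 t ht) using 1; abel)
    (fun t _ => by
      refine (hg.norm_sub_le _ _).trans ?_
      gcongr
      exact max_le (le_add_of_nonneg_right (norm_nonneg (z - z')))
          ((norm_snd_le (z - z')).trans (le_add_of_nonneg_left (norm_nonneg (γ t - γ' t)))))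
  have h2 := key.2
  simp only [h.1, h'.1] at h2
  have hz : ‖z.1 - z'.1‖ ≤ ‖z - z'‖ := norm_fst_le (z - z')
  calc _ = ‖γ 1 - γ' 1 - (z.1 - z'.1) - (w z.2 - w z'.2)‖ := by congr 1; abel
    _ ≤ _ := h2
    _ ≤ _ := mul_le_mul_of_nonneg_left (by linarith) η.coe_nonneg

end Trajectories

/-- Endpoint maps of the parametrized systems `x' = w(σ) + g(x, σ)` on `[0, 1]`: if `g` is small
and has a small Lipschitz constant on a large ball, then the endpoint map is close to
`(x, σ) ↦ x + w(σ)` in the Lipschitz sense. -/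
lemma exists_endpoint_error {n : ℕ} {F : Type*} [NormedAddCommGroup F] {w : F → Fin n → ℝ}
    {K : ℝ≥0} (hw : LipschitzWith K w) (R : ℝ) {ε : ℝ≥0} (hε : 0 < ε) :
    ∃ η : ℝ≥0, 0 < η ∧ ∃ R' : ℝ, ∀ g : (Fin n → ℝ) × F → Fin n → ℝ,
      LipschitzOnWith η g (Metric.closedBall 0 R') → ‖g 0‖ ≤ η →
      ∃ e : (Fin n → ℝ) × F → Fin n → ℝ, LipschitzWith ε e ∧ ‖e 0‖ ≤ ε ∧
        ∀ z, ‖z‖ ≤ R → ∃ γ : ℝ → Fin n → ℝ, ContinuousOn γ (Icc 0 1) ∧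
          (∀ t ∈ Ioo (0 : ℝ) 1, HasDerivAt γ (w z.2 + g (γ t, z.2)) t) ∧
          γ 0 = z.1 ∧ γ 1 = z.1 + w z.2 + e z := by
  set C : ℝ≥0 := 6 + 2 * K + 2 * ‖w 0‖₊ with hC
  have hC0 : 0 < C := by positivity
  set η : ℝ≥0 := min (1 / 2) (ε / C)
  have hη2 : η ≤ 1 / 2 := min_le_left _ _
  have hηC : (η : ℝ) * C ≤ ε := by
    have : η * C ≤ ε := (le_div_iff₀ hC0).1 (min_le_right _ _)
    exact_mod_cast this
  have hCr : (C : ℝ) = 6 + 2 * K + 2 * ‖w 0‖ := by simp [hC]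
  have hCK : (η : ℝ) * (4 + 2 * K) ≤ ε :=
    (mul_le_mul_of_nonneg_left (by linarith [norm_nonneg (w 0)]) η.coe_nonneg).trans hηC
  have hCw : (η : ℝ) * (2 * ‖w 0‖ + 2) ≤ ε :=
    (mul_le_mul_of_nonneg_left (by linarith [K.coe_nonneg]) η.coe_nonneg).trans hηC
  refine ⟨η, by positivity, 3 * R + 2 * (‖w 0‖ + K * R) + 1, fun g hg hg0 => ?_⟩
  by_cases hR : 0 ≤ R
  swap
  · exact ⟨0, LipschitzWith.const' _, by simp, fun z hz => absurd ((norm_nonneg z).trans hz) hR⟩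
  obtain ⟨G, hG, hGg⟩ := hg.extend_pi
  have hG0 : ‖G 0‖ ≤ η := by
    rwa [← hGg (Metric.mem_closedBall_self (by positivity))]
  choose γ hγ using exists_isTrajectory w hη2 hG hG0
  refine ⟨fun z => γ z 1 - z.1 - w z.2, LipschitzWith.of_dist_le_mul fun z z' => ?_, ?_,
    fun z hz => ⟨γ z, fun t ht => ((hγ z).2 t ht).continuousWithinAt, fun t ht => ?_, (hγ z).1,
      by beta_reduce; abel⟩⟩
  · rw [dist_eq_norm, dist_eq_norm]
    have hw' : ‖w z.2 - w z'.2‖ ≤ K * ‖z - z'‖ :=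
      (hw.norm_sub_le _ _).trans (by gcongr; exact norm_snd_le (z - z'))
    calc _ ≤ η * (4 * ‖z - z'‖ + 2 * ‖w z.2 - w z'.2‖) :=
          (hγ z).displacement_sub_le hη2 hG (hγ z')
      _ ≤ η * (4 * ‖z - z'‖ + 2 * (K * ‖z - z'‖)) := by gcongr
      _ = η * (4 + 2 * K) * ‖z - z'‖ := by ring
      _ ≤ ε * ‖z - z'‖ := by gcongr
  · refine ((hγ 0).norm_le hη2 hG hG0).2.trans ?_
    simpa using hCw
  · have hbd := ((hγ z).norm_le hη2 hG hG0).1 t (Ioo_subset_Icc_self ht)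
    have hwz : ‖w z.2‖ ≤ ‖w 0‖ + K * R := by
      have h1 := hw.norm_sub_le z.2 0
      rw [sub_zero] at h1
      have h2 : (K : ℝ) * ‖z.2‖ ≤ K * R := by gcongr; exact (norm_snd_le z).trans hz
      linarith [norm_le_norm_add_norm_sub' (w z.2) (w 0)]
    have hmem : (γ z t, z.2) ∈ Metric.closedBall (0 : (Fin n → ℝ) × F)
        (3 * R + 2 * (‖w 0‖ + K * R) + 1) := by
      rw [mem_closedBall_zero_iff]
      refine max_le (hbd.trans (by linarith)) (((norm_snd_le z).trans hz).trans ?_)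
      have : 0 ≤ K * R := by positivity
      linarith [norm_nonneg (w 0)]
    rw [hGg hmem]
    exact ((hγ z).2 t (Ioo_subset_Icc_self ht)).hasDerivAt (Icc_mem_nhds ht.1 ht.2)

section Reachability

variable {n m : ℕ}

/-- `Reaches X b t x y`: the point `y` is reached from `x` in time exactly `t` by concatenating
finitely many trajectories of `x' = X(x) + ∑ i, uᵢ bᵢ` with constant controls. -/
inductive Reaches (X : (Fin n → ℝ) → Fin n → ℝ) (b : Fin m → Fin n → ℝ) :
    ℝ → (Fin n → ℝ) → (Fin n → ℝ) → Prop
  | refl (x : Fin n → ℝ) : Reaches X b 0 x x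
  | snoc {t s : ℝ} {x y : Fin n → ℝ} (γ : ℝ → Fin n → ℝ) (c : Fin m → ℝ) :
      Reaches X b t x y → 0 < s → ContinuousOn γ (Icc 0 s) →
      (∀ r ∈ Ioo 0 s, HasDerivAt γ (X (γ r) + ∑ i, c i • b i) r) → γ 0 = y →
      Reaches X b (t + s) x (γ s)

variable {X : (Fin n → ℝ) → Fin n → ℝ} {b : Fin m → Fin n → ℝ}

lemma Reaches.nonneg {t : ℝ} {x y : Fin n → ℝ} (h : Reaches X b t x y) : 0 ≤ t := by
  induction h with
  | refl => exact le_rfl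
  | snoc _ _ _ hs _ _ _ ih => linarith

lemma Reaches.trans {t s : ℝ} {x y z : Fin n → ℝ} (h : Reaches X b t x y)
    (h' : Reaches X b s y z) : Reaches X b (t + s) x z := by
  induction h' with
  | refl => simpa using h
  | snoc γ c _ hs hcont hderiv h0 ih =>
    rw [← add_assoc]
    exact .snoc γ c (ih h) hs hcont hderiv h0

/-- A trajectory of the system rescaled to unit time, and translated by `a`. -/
lemma Reaches.of_unit_time {γ : ℝ → Fin n → ℝ} {τ : ℝ} (hτ : 0 < τ) (a : Fin n → ℝ)
    (c : Fin m → ℝ) (hcont : ContinuousOn γ (Icc 0 1))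
    (hderiv : ∀ t ∈ Ioo (0 : ℝ) 1,
      HasDerivAt γ (τ • (X (a + γ t) + ∑ i, c i • b i)) t) :
    Reaches X b τ (a + γ 0) (a + γ 1) := by
  have hmaps : ∀ r, r ∈ Icc 0 τ → r / τ ∈ Icc (0 : ℝ) 1 := fun r hr =>
    ⟨div_nonneg hr.1 hτ.le, (div_le_one hτ).2 hr.2⟩
  have h := Reaches.snoc (X := X) (b := b) (s := τ) (fun r => a + γ (r / τ)) c
    (Reaches.refl (a + γ 0)) hτ
    (continuousOn_const.add (hcont.comp (by fun_prop) hmaps)) (fun r hr => by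
      have h1 := hderiv (r / τ) ⟨div_pos hr.1 hτ, (div_lt_one hτ).2 hr.2⟩
      have h2 : HasDerivAt (fun r : ℝ => r / τ) (1 / τ) r := (hasDerivAt_id r).div_const τ
      convert! (h1.scomp r h2).const_add a using 1
      rw [smul_smul, one_div, inv_mul_cancel₀ hτ.ne', one_smul]) (by simp)
  simpa [hτ.ne'] using h

lemma Reaches.exists_control {t : ℝ} {x y : Fin n → ℝ} (h : Reaches X b t x y) :
    ∃ u : ℝ → Fin m → ℝ, ∃ γ : ℝ → Fin n → ℝ, ∃ S : Finset ℝ,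
      PiecewiseConstantOn u 0 t ∧ ContinuousOn γ (Icc 0 t) ∧
      (∀ r ∈ Icc 0 t \ S, HasDerivAt γ (X (γ r) + ∑ i, u r i • b i) r) ∧
      γ 0 = x ∧ γ t = y := by
  induction h with
  | refl x =>
    refine ⟨0, fun _ => x, {0}, ⟨0, fun _ => 0, rfl, rfl, monotone_const, fun k => k.elim0⟩,
      continuousOn_const, fun r hr => ?_, rfl, rfl⟩
    simp at hr
  | @snoc t s x y γ₂ c hxy hs hcont hderiv h0 ih =>
    obtain ⟨u, γ, S, ⟨N, τ, hτ0, hτN, hmono, hconst⟩, hγ, hγ', hγ0, hγt⟩ := ih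
    have ht := hxy.nonneg
    refine ⟨fun r => if r < t then u r else c, fun r => if r ≤ t then γ r else γ₂ (r - t),
      insert t (insert (t + s) S), ⟨N + 1, Fin.snoc τ (t + s), ?_, by simp, ?_, ?_⟩,
      ?_, ?_, ?_, ?_⟩
    · have : (0 : Fin (N + 1 + 1)) = Fin.castSucc 0 := rfl
      rw [this, Fin.snoc_castSucc, hτ0]
    · refine Fin.monotone_iff_le_succ.2 fun i => ?_
      rw [Fin.snoc_castSucc]
      refine Fin.lastCases ?_ (fun j => ?_) i
      · rw [Fin.succ_last, Fin.snoc_last, hτN]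
        linarith
      · rw [← Fin.castSucc_succ, Fin.snoc_castSucc]
        exact hmono (Fin.castSucc_lt_succ).le
    · intro i
      rw [Fin.snoc_castSucc]
      refine Fin.lastCases ?_ (fun j => ?_) i
      · intro r hr r' hr'
        rw [hτN] at hr hr'
        simp only [not_lt.2 hr.1.le, not_lt.2 hr'.1.le, if_false]
      · rw [← Fin.castSucc_succ, Fin.snoc_castSucc]
        intro r hr r' hr'
        have hle : τ j.succ ≤ t := hτN ▸ hmono (Fin.le_last _)
        simp only [hr.2.trans_le hle, hr'.2.trans_le hle, if_true]
        exact hconst j r hr r' hr'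
    · have hunion : Icc 0 (t + s) = Icc 0 t ∪ Icc t (t + s) :=
        (Icc_union_Icc_eq_Icc ht (by linarith)).symm
      rw [hunion]
      refine ContinuousOn.union_of_isClosed ?_ ?_ isClosed_Icc isClosed_Icc
      · exact hγ.congr fun r hr => if_pos hr.2
      · have h2 : ContinuousOn (fun r => γ₂ (r - t)) (Icc t (t + s)) :=
          hcont.comp (by fun_prop) fun r hr => ⟨by linarith [hr.1], by linarith [hr.2]⟩
        refine h2.congr fun r hr => ?_
        rcases hr.1.eq_or_lt with rfl | hlt
        · simp [hγt, h0]
        · exact if_neg (not_le.2 hlt)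
    · rintro r ⟨hr, hrS⟩
      simp only [Finset.coe_insert, Set.mem_insert_iff, not_or] at hrS
      rcases lt_or_gt_of_ne hrS.1 with hlt | hgt
      · simp only [hlt, hlt.le, if_true]
        refine (hγ' r ⟨⟨hr.1, hlt.le⟩, hrS.2.2⟩).congr_of_eventuallyEq ?_
        filter_upwards [Iio_mem_nhds hlt] with q hq using if_pos (le_of_lt hq)
      · simp only [not_lt.2 hgt.le, not_le.2 hgt, if_false]
        have hlt : r < t + s := lt_of_le_of_ne hr.2 hrS.2.1
        have h1 := (hderiv (r - t) ⟨by linarith, by linarith⟩).comp_sub_const r t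
        refine h1.congr_of_eventuallyEq ?_
        filter_upwards [Ioi_mem_nhds hgt] with q hq using if_neg (not_le.2 hq)
    · simp [ht, hγ0]
    · simp [not_le.2 hs]

end Reachability

section Steering

variable {n m : ℕ} {X : (Fin n → ℝ) → Fin n → ℝ} {b : Fin m → Fin n → ℝ}

/-- From `a + x` one reaches `a' + x + f(σ)` up to an `ε`-small and `ε`-Lipschitz error in
`(x, σ)`, in time at most `ε`, for all `(x, σ)` in the ball of radius `R`. -/
def SteersAt (X : (Fin n → ℝ) → Fin n → ℝ) (b : Fin m → Fin n → ℝ) (a a' : Fin n → ℝ)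
    (f : (Fin n → ℝ) → Fin n → ℝ) (R : ℝ) (ε : ℝ≥0) : Prop :=
  ∃ e : (Fin n → ℝ) × (Fin n → ℝ) → Fin n → ℝ, LipschitzWith ε e ∧ ‖e 0‖ ≤ ε ∧
    ∀ z, ‖z‖ ≤ R → ∃ t ≤ (ε : ℝ), Reaches X b t (a + z.1) (a' + z.1 + f z.2 + e z)

/-- The translations by `f(σ)` can be realized with arbitrarily small error, in arbitrarily small
time and on arbitrarily large balls. -/
def Steers (X : (Fin n → ℝ) → Fin n → ℝ) (b : Fin m → Fin n → ℝ)
    (f : (Fin n → ℝ) → Fin n → ℝ) : Prop :=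
  ∀ (R : ℝ) (ε : ℝ≥0), 0 < ε → SteersAt X b 0 0 f R ε

lemma exists_steersAt_comp {f : (Fin n → ℝ) → Fin n → ℝ} {K : ℝ≥0} (hf : LipschitzWith K f)
    (R : ℝ) {ε : ℝ≥0} (hε : 0 < ε) :
    ∃ δ : ℝ≥0, 0 < δ ∧ ∃ R' : ℝ, ∀ a a' a'' g, SteersAt X b a a' f R δ →
      SteersAt X b a' a'' g R' δ → SteersAt X b a a'' (f + g) R ε := by
  set C : ℝ≥0 := 3 + K + ‖f 0‖₊ with hC
  have hC0 : 0 < C := by positivity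
  set δ : ℝ≥0 := min 1 (ε / C)
  have hδ1 : δ ≤ 1 := min_le_left _ _
  have hδC : δ * C ≤ ε := (le_div_iff₀ hC0).1 (min_le_right _ _)
  have hδC' : (δ : ℝ) * (3 + K + ‖f 0‖) ≤ ε := by exact_mod_cast hδC
  refine ⟨δ, by positivity, ‖f 0‖ + 1 + (K + 2) * R, ?_⟩
  rintro a a' a'' g ⟨e₁, he₁, he₁0, h₁⟩ ⟨e₂, he₂, he₂0, h₂⟩
  set T : (Fin n → ℝ) × (Fin n → ℝ) → (Fin n → ℝ) × (Fin n → ℝ) :=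
    fun z => (z.1 + f z.2 + e₁ z, z.2) with hT
  have hTlip : LipschitzWith (K + 2) T := by
    refine (((LipschitzWith.prod_fst.add (hf.comp LipschitzWith.prod_snd)).add he₁).prodMk
      LipschitzWith.prod_snd).weaken (max_le ?_ ?_)
    · calc (1 : ℝ≥0) + K * 1 + δ ≤ 1 + K * 1 + 1 := by gcongr
        _ = K + 2 := by ring
    · exact (by norm_num : (1 : ℝ≥0) ≤ 2).trans le_add_self
  have hδ1' : (δ : ℝ) ≤ 1 := by exact_mod_cast hδ1
  have hT0 : ‖T 0‖ ≤ ‖f 0‖ + 1 := by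
    refine max_le ?_ (by change ‖(0 : Fin n → ℝ)‖ ≤ _; rw [norm_zero]; positivity)
    calc ‖(0 : Fin n → ℝ) + f 0 + e₁ 0‖ ≤ ‖f 0‖ + ‖e₁ 0‖ := by
          rw [zero_add]; exact norm_add_le _ _
      _ ≤ ‖f 0‖ + 1 := by linarith
  refine ⟨fun z => e₁ z + e₂ (T z), (he₁.add (he₂.comp hTlip)).weaken ?_, ?_, fun z hz => ?_⟩
  · calc δ + δ * (K + 2) = δ * (3 + K) := by ring
      _ ≤ δ * C := by gcongr; exact le_self_add
      _ ≤ ε := hδC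
  · have h := he₂.norm_sub_le (T 0) 0
    rw [sub_zero] at h
    have h' : (δ : ℝ) * ‖T 0‖ ≤ δ * (‖f 0‖ + 1) := by gcongr
    have hK : 0 ≤ (δ : ℝ) * K := by positivity
    linarith [norm_add_le (e₁ 0) (e₂ (T 0)), norm_le_norm_add_norm_sub' (e₂ (T 0)) (e₂ 0)]
  · obtain ⟨t₁, ht₁, hr₁⟩ := h₁ z hz
    have hTz : ‖T z‖ ≤ ‖f 0‖ + 1 + (K + 2) * R := by
      have h := hTlip.norm_sub_le z 0
      rw [sub_zero] at h
      have h' : ((K + 2 : ℝ≥0) : ℝ) * ‖z‖ ≤ (K + 2) * R := by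
        push_cast
        gcongr
      linarith [norm_le_norm_add_norm_sub' (T z) (T 0)]
    obtain ⟨t₂, ht₂, hr₂⟩ := h₂ (T z) hTz
    refine ⟨t₁ + t₂, ?_, ?_⟩
    · have : (0 : ℝ) ≤ δ * K := by positivity
      have : (0 : ℝ) ≤ δ * ‖f 0‖ := by positivity
      linarith [δ.coe_nonneg]
    · convert hr₁.trans (y := a' + z.1 + f z.2 + e₁ z) (z := _) (s := t₂) ?_ using 1
      convert! hr₂ using 1
      · simp only [hT]; abel
      · simp only [hT, Pi.add_apply]; abel

lemma Steers.add {f g : (Fin n → ℝ) → Fin n → ℝ} {K : ℝ≥0} (hf : LipschitzWith K f)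
    (h : Steers X b f) (h' : Steers X b g) : Steers X b (f + g) := by
  intro R ε hε
  obtain ⟨δ, hδ, R', hcomp⟩ := exists_steersAt_comp (X := X) (b := b) hf R hε
  exact hcomp 0 0 0 g (h R δ hδ) (h' R' δ hδ)

lemma steers_zero : Steers X b 0 := fun _ ε _ =>
  ⟨0, LipschitzWith.const' _, by simp, fun z _ => ⟨0, ε.coe_nonneg, by simpa using .refl z.1⟩⟩

lemma Steers.steersAt_zero_left {v : Fin n → ℝ} (h : Steers X b fun _ => v) (R : ℝ) {ε : ℝ≥0}
    (hε : 0 < ε) : SteersAt X b 0 v 0 R ε := by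
  obtain ⟨e, he, he0, hr⟩ := h R ε hε
  refine ⟨e, he, he0, fun z hz => ?_⟩
  obtain ⟨t, ht, h⟩ := hr z hz
  refine ⟨t, ht, ?_⟩
  convert! h using 1
  simp only [Pi.zero_apply]
  abel

lemma Steers.steersAt_zero_right {v : Fin n → ℝ} (h : Steers X b fun _ => -v) (R : ℝ) {ε : ℝ≥0}
    (hε : 0 < ε) : SteersAt X b v 0 0 R ε := by
  set C : ℝ≥0 := 1 + ‖v‖₊ with hC
  have hC0 : 0 < C := by positivity
  have hεC : ((ε / C : ℝ≥0) : ℝ) * (1 + ‖v‖) ≤ ε := by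
    have : ε / C * C ≤ ε := (div_mul_cancel₀ ε hC0.ne').le
    exact_mod_cast this
  obtain ⟨e, he, he0, hr⟩ := h (‖v‖ + R) (ε / C) (by positivity)
  have hεC' : ε / C ≤ ε := div_le_self zero_le le_self_add
  have hT : LipschitzWith 1 fun z : (Fin n → ℝ) × (Fin n → ℝ) => (v + z.1, z.2) := by
    refine LipschitzWith.of_dist_le_mul fun z z' => ?_
    simp [Prod.dist_eq]
  refine ⟨fun z => e (v + z.1, z.2), (he.comp hT).weaken (by simpa using hεC'), ?_,
    fun z hz => ?_⟩
  · have h1 := he.norm_sub_le (v, 0) 0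
    have h2 : ‖(v, (0 : Fin n → ℝ))‖ = ‖v‖ := by simp [Prod.norm_def]
    rw [sub_zero, h2] at h1
    simp only [Prod.fst_zero, Prod.snd_zero, add_zero]
    linarith [norm_le_norm_add_norm_sub' (e (v, 0)) (e 0)]
  · obtain ⟨t, ht, h⟩ := hr (v + z.1, z.2) (max_le
      ((norm_add_le _ _).trans (by gcongr; exact (norm_fst_le z).trans hz))
      (((norm_snd_le z).trans hz).trans (le_add_of_nonneg_left (norm_nonneg v))))
    refine ⟨t, ht.trans (by exact_mod_cast hεC'), ?_⟩
    convert! h using 1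
    · simp
    · simp only [Pi.zero_apply]; abel

/-- Steering along a vector field which, after rescaling of time by `τ(σ)`, is close to the
constant field `w(σ)`. -/
lemma exists_steersAt_of_close {w : (Fin n → ℝ) → Fin n → ℝ} {K : ℝ≥0}
    (hw : LipschitzWith K w) (R : ℝ) {ε : ℝ≥0} (hε : 0 < ε) :
    ∃ η : ℝ≥0, 0 < η ∧ ∃ R' : ℝ, ∀ (g : (Fin n → ℝ) × (Fin n → ℝ) → Fin n → ℝ)
      (a : Fin n → ℝ) (τ : (Fin n → ℝ) → ℝ) (c : (Fin n → ℝ) → Fin m → ℝ),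
      LipschitzOnWith η g (Metric.closedBall 0 R') → ‖g 0‖ ≤ η →
      (∀ σ, ‖σ‖ ≤ R → 0 < τ σ ∧ τ σ ≤ ε) →
      (∀ x σ, τ σ • (X (a + x) + ∑ i, c σ i • b i) = w σ + g (x, σ)) →
      SteersAt X b a a w R ε := by
  obtain ⟨η, hη, R', h⟩ := exists_endpoint_error hw R hε
  refine ⟨η, hη, R', fun g a τ c hg hg0 hτ hfield => ?_⟩
  obtain ⟨e, he, he0, hγ⟩ := h g hg hg0
  refine ⟨e, he, he0, fun z hz => ?_⟩
  obtain ⟨γ, hcont, hderiv, h0, h1⟩ := hγ z hz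
  obtain ⟨hτ0, hτε⟩ := hτ z.2 ((norm_snd_le z).trans hz)
  refine ⟨τ z.2, hτε, ?_⟩
  have := Reaches.of_unit_time (X := X) (b := b) hτ0 a (c z.2) hcont fun t ht => by
    rw [hfield]
    exact hderiv t ht
  rw [h0, h1] at this
  convert! this using 1
  abel

lemma LipschitzWith.smul_vector {E F : Type*} [PseudoMetricSpace E] [NormedAddCommGroup F]
    [NormedSpace ℝ F] {ℓ : E → ℝ} {K : ℝ≥0} (hℓ : LipschitzWith K ℓ) (v : F) :
    LipschitzWith (K * ‖v‖₊) fun σ => ℓ σ • v := by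
  refine LipschitzWith.of_dist_le_mul fun σ σ' => ?_
  rw [dist_eq_norm, ← sub_smul, norm_smul, ← dist_eq_norm]
  have := hℓ.dist_le_mul σ σ'
  calc _ ≤ K * dist σ σ' * ‖v‖ := by gcongr
    _ = _ := by push_cast; ring

lemma ContDiff.exists_lipschitzOnWith_closedBall {E F : Type*} [NormedAddCommGroup E]
    [NormedSpace ℝ E] [ProperSpace E] [NormedAddCommGroup F] [NormedSpace ℝ F] {f : E → F}
    (hf : ContDiff ℝ 1 f) (R : ℝ) : ∃ L, LipschitzOnWith L f (Metric.closedBall 0 R) :=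
  hf.contDiffOn.exists_lipschitzOnWith one_ne_zero (convex_closedBall 0 R)
    (isCompact_closedBall 0 R)

lemma steers_control (hX : ContDiff ℝ 1 X) (i : Fin m) {ℓ : (Fin n → ℝ) → ℝ} {K : ℝ≥0}
    (hℓ : LipschitzWith K ℓ) : Steers X b fun σ => ℓ σ • b i := by
  intro R ε hε
  obtain ⟨η, hη, R', h⟩ := exists_steersAt_of_close (X := X) (b := b) (hℓ.smul_vector (b i)) R hε
  obtain ⟨L, hL⟩ := hX.exists_lipschitzOnWith_closedBall R'
  set C : ℝ≥0 := L + ‖X 0‖₊ + 1 with hC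
  have hC0 : 0 < C := by positivity
  set δ : ℝ≥0 := min ε (η / C)
  have hδ0 : 0 < δ := by positivity
  have hδC : δ * C ≤ η := (le_div_iff₀ hC0).1 (min_le_right _ _)
  have hδC' : (δ : ℝ) * (L + ‖X 0‖ + 1) ≤ η := by exact_mod_cast hδC
  have hδr : (0 : ℝ) < δ := hδ0
  have hLδ : (δ : ℝ) * L ≤ η :=
    (mul_le_mul_of_nonneg_left (by linarith [norm_nonneg (X 0)]) hδr.le).trans hδC'
  have hXδ : (δ : ℝ) * ‖X 0‖ ≤ η :=
    (mul_le_mul_of_nonneg_left (by linarith [L.coe_nonneg]) hδr.le).trans hδC'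
  refine h (fun z => (δ : ℝ) • X z.1) 0 (fun _ => δ) (fun σ => Pi.single i (ℓ σ / δ))
    (LipschitzOnWith.of_dist_le_mul fun z hz z' hz' => ?_) ?_
    (fun σ _ => ⟨hδr, by exact_mod_cast min_le_left _ _⟩) fun x σ => ?_
  · rw [dist_eq_norm, ← smul_sub, norm_smul, Real.norm_of_nonneg hδr.le, ← dist_eq_norm]
    rw [mem_closedBall_zero_iff] at hz hz'
    have h1 := hL.dist_le_mul z.1 (mem_closedBall_zero_iff.2 ((norm_fst_le z).trans hz)) z'.1
      (mem_closedBall_zero_iff.2 ((norm_fst_le z').trans hz'))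
    have h2 : dist z.1 z'.1 ≤ dist z z' := le_max_left _ _
    calc _ ≤ (δ : ℝ) * (L * dist z z') := by gcongr; exact h1.trans (by gcongr)
      _ = δ * L * dist z z' := by ring
      _ ≤ η * dist z z' := by gcongr
  · simpa [norm_smul] using hXδ
  · have hsum : ∑ j, (Pi.single i (ℓ σ / δ) : Fin m → ℝ) j • b j = (ℓ σ / δ) • b i := by
      rw [Finset.sum_eq_single i (fun j _ hj => by simp [hj]) (by simp)]
      simp
    rw [hsum, smul_add, smul_smul, mul_div_cancel₀ _ hδr.ne', zero_add, add_comm]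

/-- Near `h⁻¹ v`, the field `∑ j ≤ k, p j` rescaled by `h ^ k` is close to the constant field
`p k v`, together with its Lipschitz constant, as `h → 0`. -/
lemma exists_rescaled_close {E : Type*} [NormedAddCommGroup E] [NormedSpace ℝ E] [ProperSpace E]
    {k : ℕ} {p : ℕ → E → E} (hp : ∀ j, ContDiff ℝ 1 (p j))
    (hom : ∀ j ≤ k, ∀ (c : ℝ) x, p j (c • x) = c ^ j • p j x) (v : E) (R : ℝ) {η : ℝ≥0}
    (hη : 0 < η) :
    ∃ h : ℝ, 0 < h ∧ h ≤ 1 ∧ h ≤ η ∧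
      LipschitzOnWith η (fun ξ => h ^ k • (∑ j ∈ Finset.range (k + 1), p j (h⁻¹ • v + ξ)) - p k v)
        (Metric.closedBall 0 R) ∧
      ‖h ^ k • (∑ j ∈ Finset.range (k + 1), p j (h⁻¹ • v + 0)) - p k v‖ ≤ η := by
  set F : ℝ × E → E := fun z =>
    (∑ j ∈ Finset.range (k + 1), z.1 ^ (k - j) • p j (v + z.2)) - p k v with hF
  have hFc : ContDiff ℝ 1 F := by
    refine ContDiff.sub (ContDiff.sum fun j _ => ?_) contDiff_const
    exact (contDiff_fst.pow _).smul ((hp j).comp (contDiff_const.add contDiff_snd))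
  obtain ⟨L, hL⟩ := hFc.exists_lipschitzOnWith_closedBall (max 1 R)
  have hF0 : F 0 = 0 := by
    simp only [hF, Prod.fst_zero, Prod.snd_zero, add_zero]
    rw [Finset.sum_range_succ, Finset.sum_eq_zero, Nat.sub_self, pow_zero, one_smul, zero_add,
      sub_self]
    intro j hj
    rw [zero_pow (by have := Finset.mem_range.1 hj; omega), zero_smul]
  set h' : ℝ≥0 := min 1 (η / (L + 1))
  have hL0 : 0 < L + 1 := by positivity
  have hpos : 0 < h' := by positivity
  have hhL : h' * (L + 1) ≤ η := (le_div_iff₀ hL0).1 (min_le_right _ _)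
  obtain ⟨h, hh⟩ : ∃ h : ℝ, (h' : ℝ) = h := ⟨_, rfl⟩
  have h0 : 0 < h := hh ▸ NNReal.coe_pos.2 hpos
  have h1 : h ≤ 1 := hh ▸ NNReal.coe_le_coe.2 (min_le_left _ _ : h' ≤ 1)
  have hLη : h * (L + 1) ≤ η := hh ▸ by exact_mod_cast hhL
  have hLη' : L * h ≤ η := by linarith
  have hscale : ∀ ξ, h ^ k • (∑ j ∈ Finset.range (k + 1), p j (h⁻¹ • v + ξ)) - p k v
      = F (h, h • ξ) := by
    intro ξ
    simp only [hF, Finset.smul_sum]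
    congr 1
    refine Finset.sum_congr rfl fun j hj => ?_
    have hjk : j ≤ k := by have := Finset.mem_range.1 hj; omega
    have : v + h • ξ = h • (h⁻¹ • v + ξ) := by
      rw [smul_add, smul_smul, mul_inv_cancel₀ h0.ne', one_smul]
    rw [this, hom j hjk, smul_smul, ← pow_add, Nat.sub_add_cancel hjk]
  have hmem : ∀ ξ ∈ Metric.closedBall (0 : E) R,
      (h, h • ξ) ∈ Metric.closedBall (0 : ℝ × E) (max 1 R) := by
    intro ξ hξ
    rw [mem_closedBall_zero_iff] at hξ ⊢
    refine max_le ?_ ?_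
    · rw [Real.norm_of_nonneg h0.le]
      exact h1.trans (le_max_left _ _)
    · rw [norm_smul, Real.norm_of_nonneg h0.le]
      exact (mul_le_of_le_one_left (norm_nonneg ξ) h1).trans (hξ.trans (le_max_right _ _))
  refine ⟨h, h0, h1, ?_, LipschitzOnWith.of_dist_le_mul fun ξ hξ ξ' hξ' => ?_, ?_⟩
  · have : 0 ≤ h * L := by positivity
    linarith
  · simp only [hscale]
    have hd : dist (h, h • ξ) (h, h • ξ') = h * dist ξ ξ' := by
      rw [Prod.dist_eq, dist_self, max_eq_right dist_nonneg, dist_smul₀,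
        Real.norm_of_nonneg h0.le]
    calc _ ≤ L * dist (h, h • ξ) (h, h • ξ') := hL.dist_le_mul _ (hmem ξ hξ) _ (hmem ξ' hξ')
      _ = L * h * dist ξ ξ' := by rw [hd]; ring
      _ ≤ η * dist ξ ξ' := by gcongr
  · rw [hscale, smul_zero]
    have h2 : (h, (0 : E)) ∈ Metric.closedBall (0 : ℝ × E) (max 1 R) := by
      simp [Prod.norm_def, abs_of_pos h0, h1, h0.le]
    have h3 := hL.dist_le_mul _ h2 0 (Metric.mem_closedBall_self (by positivity))
    rw [hF0, dist_zero_right, dist_zero_right] at h3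
    have h4 : ‖(h, (0 : E))‖ = h := by simp [Prod.norm_def, abs_of_pos h0, h0.le]
    rw [h4] at h3
    exact h3.trans hLη'

variable {k : ℕ} {p : ℕ → (Fin n → ℝ) → Fin n → ℝ}

lemma exists_steersAt_drift (hk : k ≠ 0) (hp : ∀ j, ContDiff ℝ 1 (p j))
    (hom : ∀ j ≤ k, ∀ (c : ℝ) x, p j (c • x) = c ^ j • p j x)
    (hX : ∀ x, X x = ∑ j ∈ Finset.range (k + 1), p j x) (v : Fin n → ℝ)
    {ℓ : (Fin n → ℝ) → ℝ} {K : ℝ≥0} (hℓ : LipschitzWith K ℓ) (hpos : ∀ σ, 0 < ℓ σ)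
    (R : ℝ) {ε : ℝ≥0} (hε : 0 < ε) :
    ∃ a : ℝ, SteersAt X b (a • v) (a • v) (fun σ => ℓ σ • p k v) R ε := by
  obtain ⟨η, hη, R', H⟩ := exists_steersAt_of_close (X := X) (b := b) (hℓ.smul_vector (p k v)) R hε
  set ρ : ℝ≥0 := (max R R').toNNReal
  have hRρ : R ≤ ρ := (le_max_left R R').trans (Real.le_coe_toNNReal _)
  have hR'ρ : R' ≤ ρ := (le_max_right R R').trans (Real.le_coe_toNNReal _)
  set A : ℝ≥0 := ‖ℓ 0‖₊ + K * ρ with hA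
  have hℓA : ∀ σ, ‖σ‖ ≤ ρ → ‖ℓ σ‖ ≤ A := by
    intro σ hσ
    have h1 := hℓ.norm_sub_le σ 0
    rw [sub_zero] at h1
    have h2 : (K : ℝ) * ‖σ‖ ≤ K * ρ := by gcongr
    have h3 : (A : ℝ) = ‖ℓ 0‖ + K * ρ := by simp [hA]
    linarith [norm_le_norm_add_norm_sub' (ℓ σ) (ℓ 0)]
  set C : ℝ≥0 := A + K * (1 + ρ) + 1 with hC
  have hC0 : 0 < C := by positivity
  have hCr : (C : ℝ) = A + K * (1 + ρ) + 1 := by simp [hC]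
  set η' : ℝ≥0 := min η ε / C
  have hη'0 : 0 < η' := by positivity
  have hη'C : η' * C = min η ε := div_mul_cancel₀ _ hC0.ne'
  have hCη : (η' : ℝ) * C ≤ η := by exact_mod_cast hη'C.le.trans (min_le_left _ _)
  have hCε : (η' : ℝ) * C ≤ ε := by exact_mod_cast hη'C.le.trans (min_le_right _ _)
  have hAC : (A : ℝ) ≤ C := by
    have : (0 : ℝ) ≤ K * (1 + ρ) := by positivity
    linarith
  obtain ⟨h, h0, h1, hhη, hlip, hq0⟩ := exists_rescaled_close hp hom v R' hη'0
  set q : (Fin n → ℝ) → Fin n → ℝ := fun ξ =>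
    h ^ k • (∑ j ∈ Finset.range (k + 1), p j (h⁻¹ • v + ξ)) - p k v with hq
  change ‖q 0‖ ≤ η' at hq0
  refine ⟨h⁻¹, H (fun z => ℓ z.2 • q z.1) _ (fun σ => ℓ σ * h ^ k) (fun _ => 0)
    (LipschitzOnWith.of_dist_le_mul fun z hz z' hz' => ?_) ?_ (fun σ hσ => ⟨?_, ?_⟩)
    fun x σ => ?_⟩
  · rw [mem_closedBall_zero_iff] at hz hz'
    have hR' : 0 ≤ R' := (norm_nonneg z).trans hz
    have hd1 : ‖q z.1 - q z'.1‖ ≤ η' * dist z z' := by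
      rw [← dist_eq_norm]
      refine (hlip.dist_le_mul z.1 (mem_closedBall_zero_iff.2 ((norm_fst_le z).trans hz)) z'.1
        (mem_closedBall_zero_iff.2 ((norm_fst_le z').trans hz'))).trans ?_
      gcongr
      exact le_max_left _ _
    have hd2 : ‖ℓ z.2 - ℓ z'.2‖ ≤ K * dist z z' := by
      rw [← dist_eq_norm]
      refine (hℓ.dist_le_mul _ _).trans ?_
      gcongr
      exact le_max_right _ _
    have hqb : ‖q z'.1‖ ≤ η' * (1 + ρ) := by
      have h2 := hlip.norm_sub_le (mem_closedBall_zero_iff.2 ((norm_fst_le z').trans hz'))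
        (Metric.mem_closedBall_self hR')
      rw [sub_zero] at h2
      have h3 : (η' : ℝ) * ‖z'.1‖ ≤ η' * ρ := by
        gcongr
        exact (norm_fst_le z').trans (hz'.trans hR'ρ)
      linarith [norm_le_norm_add_norm_sub' (q z'.1) (q 0)]
    have hℓb := hℓA z.2 ((norm_snd_le z).trans (hz.trans hR'ρ))
    have hsplit : ℓ z.2 • q z.1 - ℓ z'.2 • q z'.1
        = ℓ z.2 • (q z.1 - q z'.1) + (ℓ z.2 - ℓ z'.2) • q z'.1 := by
      rw [smul_sub (ℓ z.2) (q z.1) (q z'.1), sub_smul]; abel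
    calc dist (ℓ z.2 • q z.1) (ℓ z'.2 • q z'.1)
        ≤ ‖ℓ z.2‖ * ‖q z.1 - q z'.1‖ + ‖ℓ z.2 - ℓ z'.2‖ * ‖q z'.1‖ := by
          rw [dist_eq_norm, hsplit, ← norm_smul, ← norm_smul]
          exact norm_add_le _ _
      _ ≤ A * (η' * dist z z') + K * dist z z' * (η' * (1 + ρ)) := by gcongr
      _ = η' * (A + K * (1 + ρ)) * dist z z' := by ring
      _ ≤ η' * C * dist z z' := by gcongr; linarith
      _ ≤ η * dist z z' := by gcongr
  · rw [norm_smul]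
    have := hℓA 0 (by simp)
    calc ‖ℓ 0‖ * ‖q 0‖ ≤ C * η' := by gcongr; exact this.trans hAC
      _ ≤ η := by rw [mul_comm]; exact hCη
  · have := hpos σ
    positivity
  · have h2 : ℓ σ ≤ C := (Real.le_norm_self _).trans ((hℓA σ (hσ.trans hRρ)).trans hAC)
    calc ℓ σ * h ^ k ≤ C * η' := by
          gcongr
          exact (pow_le_of_le_one h0.le h1 hk).trans hhη
      _ ≤ ε := by rw [mul_comm]; exact hCε
  · simp only [hq, hX, Pi.zero_apply, zero_smul, Finset.sum_const_zero, add_zero]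
    rw [smul_sub, smul_smul]
    abel

/-- If all multiples of `v` can be realized as translations, then so can the multiples of `p k v`
by positive functions of the parameter. -/
lemma steers_leading_part_of_pos (hk : k ≠ 0) (hp : ∀ j, ContDiff ℝ 1 (p j))
    (hom : ∀ j ≤ k, ∀ (c : ℝ) x, p j (c • x) = c ^ j • p j x)
    (hX : ∀ x, X x = ∑ j ∈ Finset.range (k + 1), p j x) {v : Fin n → ℝ}
    (hv : ∀ a : ℝ, Steers X b fun _ => a • v) {ℓ : (Fin n → ℝ) → ℝ} {K : ℝ≥0}
    (hℓ : LipschitzWith K ℓ) (hpos : ∀ σ, 0 < ℓ σ) : Steers X b fun σ => ℓ σ • p k v := by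
  intro R ε hε
  obtain ⟨δ₂, hδ₂, R₂, hcomp₂⟩ := exists_steersAt_comp (X := X) (b := b)
    (hℓ.smul_vector (p k v)) R hε
  obtain ⟨δ₁, hδ₁, R₁, hcomp₁⟩ := exists_steersAt_comp (X := X) (b := b)
    (f := (0 : (Fin n → ℝ) → Fin n → ℝ)) (LipschitzWith.const' 0 : LipschitzWith 0 _) R hδ₂
  obtain ⟨a, ha⟩ := exists_steersAt_drift (X := X) (b := b) hk hp hom hX v hℓ hpos R₁ hδ₁
  have h₁ := hcomp₁ _ _ _ _ ((hv a).steersAt_zero_left R hδ₁) ha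
  rw [zero_add] at h₁
  have hv' : Steers X b fun _ => -(a • v) := by
    simpa only [neg_smul] using hv (-a)
  simpa using! hcomp₂ _ _ _ _ h₁ (hv'.steersAt_zero_right R₂ hδ₂)

lemma steers_leading_part (hk : Odd k) (hp : ∀ j, ContDiff ℝ 1 (p j))
    (hom : ∀ j ≤ k, ∀ (c : ℝ) x, p j (c • x) = c ^ j • p j x)
    (hX : ∀ x, X x = ∑ j ∈ Finset.range (k + 1), p j x) {v : Fin n → ℝ}
    (hv : ∀ a : ℝ, Steers X b fun _ => a • v) {ℓ : (Fin n → ℝ) → ℝ} {K : ℝ≥0}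
    (hℓ : LipschitzWith K ℓ) : Steers X b fun σ => ℓ σ • p k v := by
  have hk0 : k ≠ 0 := hk.pos.ne'
  have hpos : LipschitzWith (K + 0) fun σ => max (ℓ σ) 0 + 1 :=
    (hℓ.max_const 0).add (LipschitzWith.const' 1)
  have hneg : LipschitzWith (K + 0) fun σ => max (-ℓ σ) 0 + 1 :=
    (hℓ.neg.max_const 0).add (LipschitzWith.const' 1)
  have hodd : p k (-v) = -p k v := by
    rw [← neg_one_smul ℝ v, hom k le_rfl, hk.neg_one_pow, neg_one_smul]
  have h₁ := steers_leading_part_of_pos (X := X) (b := b) hk0 hp hom hX hv hpos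
    fun σ => by positivity
  have h₂ := steers_leading_part_of_pos (X := X) (b := b) hk0 hp hom hX (v := -v)
    (fun a => by simpa only [neg_smul, smul_neg] using hv (-a)) hneg fun σ => by positivity
  convert! h₁.add (hpos.smul_vector (p k v)) h₂ using 1
  funext σ
  rw [Pi.add_apply, hodd, smul_neg, ← sub_eq_add_neg, ← sub_smul]
  congr 1
  rcases le_total (ℓ σ) 0 with h | h
  · rw [max_eq_right h, max_eq_left (by linarith)]; ring
  · rw [max_eq_left h, max_eq_right (by linarith)]; ring

/-- The directions along which translations by any Lipschitz multiple can be realized. -/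
def steeringDirections (X : (Fin n → ℝ) → Fin n → ℝ) (b : Fin m → Fin n → ℝ) :
    Submodule ℝ (Fin n → ℝ) where
  carrier := {v | ∀ (ℓ : (Fin n → ℝ) → ℝ) (K : ℝ≥0), LipschitzWith K ℓ →
    Steers X b fun σ => ℓ σ • v}
  zero_mem' := fun ℓ K _ => by simpa using! steers_zero (X := X) (b := b)
  add_mem' := fun {v v'} hv hv' ℓ K hℓ => by
    simpa only [smul_add] using! (hv ℓ K hℓ).add (hℓ.smul_vector v) (hv' ℓ K hℓ)
  smul_mem' := fun c v hv ℓ K hℓ => by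
    simpa only [smul_smul, smul_eq_mul] using! hv _ _ (hℓ.smul_vector c)

/-- If every direction is a steering direction, then the errors can be corrected by a fixed point
argument, and every point is reached exactly. -/
lemma exists_reaches_of_steeringDirections_eq_top (h : steeringDirections X b = ⊤)
    (x y : Fin n → ℝ) {T : ℝ} (hT : 0 < T) : ∃ t ≤ T, Reaches X b t x y := by
  have hsum : ∀ s : Finset (Fin n),
      Steers X b (∑ i ∈ s, fun σ : Fin n → ℝ => σ i • (Pi.single i (1 : ℝ) : Fin n → ℝ)) := by
    intro s
    induction s using Finset.induction_on with
    | empty => simpa using steers_zero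
    | insert i s his ih =>
      rw [Finset.sum_insert his]
      have hmem : (Pi.single i (1 : ℝ) : Fin n → ℝ) ∈ steeringDirections X b := h ▸ trivial
      have hproj : LipschitzWith 1 fun σ : Fin n → ℝ => σ i := LipschitzWith.eval i
      exact (hmem _ _ hproj).add (hproj.smul_vector _) ih
  have hid : Steers X b id := by
    convert! hsum Finset.univ using 1
    funext σ
    rw [Finset.sum_apply]
    exact pi_eq_sum_univ' σ
  set ε : ℝ≥0 := min (1 / 2) T.toNNReal
  have hT' : 0 < T.toNNReal := Real.toNNReal_pos.2 hT
  have hε0 : 0 < ε := by positivity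
  have hε2 : (ε : ℝ) ≤ 1 / 2 := by exact_mod_cast (min_le_left _ _ : ε ≤ 1 / 2)
  have hεT : (ε : ℝ) ≤ T := by
    have : (ε : ℝ) ≤ T.toNNReal := by exact_mod_cast (min_le_right _ _ : ε ≤ T.toNNReal)
    rwa [Real.coe_toNNReal T hT.le] at this
  obtain ⟨e, he, he0, hr⟩ := hid (2 * (‖y - x‖ + 1 + ‖x‖)) ε hε0
  have hφ : LipschitzWith (0 + ε * 1) fun σ => (y - x) - e (x, σ) :=
    (LipschitzWith.const' (y - x)).sub (he.comp (LipschitzWith.prodMk_left x))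
  have hcontr : ContractingWith (0 + ε * 1) fun σ => (y - x) - e (x, σ) := by
    refine ⟨?_, hφ⟩
    rw [zero_add, mul_one, ← NNReal.coe_lt_coe]
    exact hε2.trans_lt (by norm_num)
  set σ := hcontr.fixedPoint
  have hfix : (y - x) - e (x, σ) = σ := hcontr.fixedPoint_isFixedPt
  have hnorm : ‖(x, σ)‖ ≤ 2 * (‖y - x‖ + 1 + ‖x‖) := by
    have h1 := he.norm_sub_le (x, σ) 0
    rw [sub_zero] at h1
    have h2 : ‖(x, σ)‖ ≤ ‖x‖ + ‖σ‖ :=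
      max_le (le_add_of_nonneg_right (norm_nonneg _)) (le_add_of_nonneg_left (norm_nonneg _))
    have h3 : ε * ‖(x, σ)‖ ≤ 1 / 2 * (‖x‖ + ‖σ‖) := by gcongr
    have h4 : ‖σ‖ ≤ ‖y - x‖ + ‖e (x, σ)‖ := by
      conv_lhs => rw [← hfix]
      exact norm_sub_le _ _
    have h5 := norm_le_norm_add_norm_sub' (e (x, σ)) (e 0)
    refine max_le ?_ ?_
    · change ‖x‖ ≤ _
      linarith [norm_nonneg (y - x), norm_nonneg x]
    · change ‖σ‖ ≤ _
      linarith [norm_nonneg x]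
  obtain ⟨t, ht, hreach⟩ := hr (x, σ) hnorm
  refine ⟨t, ht.trans hεT, ?_⟩
  convert! hreach using 1
  · simp
  · simp only [id, zero_add]
    rw [add_assoc, ← sub_eq_iff_eq_add.1 hfix]
    abel

end Steering

lemma MvPolynomial.contDiff_eval {ι : Type*} [Fintype ι] (q : MvPolynomial ι ℝ) :
    ContDiff ℝ 1 fun x : ι → ℝ => MvPolynomial.eval x q := by
  induction q using MvPolynomial.induction_on with
  | C a => simpa using contDiff_const
  | add p q hp hq => simpa using hp.add hq
  | mul_X p i hp => simpa using hp.mul (contDiff_apply ℝ ℝ i)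

lemma MvPolynomial.IsHomogeneous.eval_smul {ι : Type*} {q : MvPolynomial ι ℝ} {j : ℕ}
    (hq : q.IsHomogeneous j) (c : ℝ) (x : ι → ℝ) :
    MvPolynomial.eval (c • x) q = c ^ j * MvPolynomial.eval x q := by
  rw [MvPolynomial.eval_eq, MvPolynomial.eval_eq, Finset.mul_sum]
  refine Finset.sum_congr rfl fun d hd => ?_
  have hdeg : ∑ i ∈ d.support, d i = j := by
    simpa [Finsupp.weight_apply, Finsupp.sum] using hq (MvPolynomial.mem_support_iff.1 hd)
  simp only [Pi.smul_apply, smul_eq_mul, mul_pow]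
  rw [Finset.prod_mul_distrib, Finset.prod_pow_eq_pow_sum, hdeg]
  ring

/-- **Strong controllability of affine systems with odd-degree polynomial drift**
(Theorem 5.1, after Jurdjevic–Kupka): consider the system
`ẋ = X₀(x) + Σᵢ uᵢ(t)·bᵢ` on `ℝⁿ`, where `X₀ = p₀ + p₁ + ⋯ + p_k` with each `p_j` a vector
field whose components are homogeneous polynomials of degree `j`, `k` odd, and
`b₁, …, b_m` constant vectors. If the smallest subspace of `ℝⁿ` containing the `bᵢ` and
invariant under `p_k` is `ℝⁿ`, then every point is reachable from every point in time at most
`T`, for every `T > 0`, using piecewise constant controls. -/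
theorem strong_controllability (n m k : ℕ) (hn : 1 ≤ n) (hk : Odd k)
    (b : Fin m → (Fin n → ℝ))
    (P : ℕ → Fin n → MvPolynomial (Fin n) ℝ)
    (hP : ∀ j ≤ k, ∀ i, (P j i).IsHomogeneous j)
    (hspan : ∀ W : Submodule ℝ (Fin n → ℝ), (∀ i, b i ∈ W) →
      (∀ w ∈ W, (fun i => MvPolynomial.eval w (P k i)) ∈ W) → W = ⊤) :
    ∀ x : Fin n → ℝ, ∀ T : ℝ, 0 < T → ∀ y : Fin n → ℝ,
      ∃ t ∈ Icc (0 : ℝ) T, ∃ u : ℝ → Fin m → ℝ, ∃ γ : ℝ → (Fin n → ℝ), ∃ S : Finset ℝ,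
        PiecewiseConstantOn u 0 t ∧
        ContinuousOn γ (Icc 0 t) ∧
        (∀ r ∈ Icc 0 t \ S, HasDerivAt γ
          ((fun i => ∑ j ∈ Finset.range (k + 1), MvPolynomial.eval (γ r) (P j i))
            + ∑ i : Fin m, u r i • b i) r) ∧
        γ 0 = x ∧ γ t = y := by
  intro x T hT y
  set p : ℕ → (Fin n → ℝ) → Fin n → ℝ := fun j x i => MvPolynomial.eval x (P j i)
  set X : (Fin n → ℝ) → Fin n → ℝ := fun x i =>
    ∑ j ∈ Finset.range (k + 1), MvPolynomial.eval x (P j i)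
  have hp : ∀ j, ContDiff ℝ 1 (p j) := fun j =>
    contDiff_pi.2 fun i => MvPolynomial.contDiff_eval (P j i)
  have hom : ∀ j ≤ k, ∀ (c : ℝ) x, p j (c • x) = c ^ j • p j x := fun j hj c x =>
    funext fun i => (hP j hj i).eval_smul c x
  have hX : ∀ x, X x = ∑ j ∈ Finset.range (k + 1), p j x := fun x =>
    funext fun i => (Finset.sum_apply i _ fun j => p j x).symm
  have hXc : ContDiff ℝ 1 X :=
    contDiff_pi.2 fun i => ContDiff.sum fun j _ => MvPolynomial.contDiff_eval (P j i)
  have htop : steeringDirections X b = ⊤ :=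
    hspan _ (fun i ℓ K hℓ => steers_control hXc i hℓ) fun w hw ℓ K hℓ =>
      steers_leading_part hk hp hom hX (fun a => hw (fun _ => a) 0 (LipschitzWith.const' a)) hℓ
  obtain ⟨t, ht, hr⟩ := exists_reaches_of_steeringDirections_eq_top htop x y hT
  obtain ⟨u, γ, S, h⟩ := hr.exists_control
  exact ⟨t, ⟨hr.nonneg, ht⟩, u, γ, S, h⟩
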